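/- For every positive integer n, the infinite product ∏_{p prime, p > 199} (1 + A(n,p)) converges and satisfies ∏_{p prime, p > 199} (1 + A(n,p)) ≥ 0.943671. -/

import Mathlib

open MeasureTheory Finset
open scoped Classical

noncomputable section

/-- `eu x = e(x) = exp(2πix)`. -/
def eu (x : ℝ) : ℂ := Complex.exp (2 * Real.pi * Complex.I * x)

/-- `Cq i q a = ∑_{1 ≤ m ≤ q, gcd(m,q)=1} e(a m^i / q)`. -/
def Cq (i q a : ℕ) : ℂ :=
  ∑ m ∈ (Finset.Icc 1 q).filter (fun m => Nat.gcd m q = 1), eu ((a * m ^ i : ℝ) / q)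

/-- `Afun n q = Re( μ(q)/φ(q)^4 · ∑_{1 ≤ a ≤ q, (a,q)=1} C₂(q,a) C₃(q,a)² e(-an/q) )`. -/
def Afun (n q : ℕ) : ℝ :=
  (((ArithmeticFunction.moebius q : ℤ) : ℂ) / ((Nat.totient q : ℂ)) ^ 4 *
    ∑ a ∈ (Finset.Icc 1 q).filter (fun a => Nat.gcd a q = 1),
      Cq 2 q a * (Cq 3 q a) ^ 2 * eu (-(a * n : ℝ) / q)).re

/-- the singular series `𝔖(n) = ∑_{q=1}^∞ A(n,q)`. -/
def SSfun (n : ℕ) : ℝ := ∑' q : ℕ+, Afun n (q : ℕ)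

/-- `U = (N/(16(1+δ)))^{1/3}` with `δ = 10⁻⁴`. -/
def Uconst (N : ℕ) : ℝ := ((N : ℝ) / (16 * (1 + 1e-4))) ^ ((1 : ℝ) / 3)

/-- `V = U^{5/6}`. -/
def Vconst (N : ℕ) : ℝ := Uconst N ^ ((5 : ℝ) / 6)

/-- `f(α) = ∑_{p ≤ N} (log p) e(pα)`. -/
def fsum (N : ℕ) (α : ℝ) : ℂ :=
  ∑ p ∈ (Finset.range (N + 1)).filter Nat.Prime, (Real.log p : ℂ) * eu (p * α)

/-- `g(α) = ∑_{p ≤ N^{1/2}} (log p) e(p²α)`. -/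
def gsum (N : ℕ) (α : ℝ) : ℂ :=
  ∑ p ∈ (Finset.range (N + 1)).filter (fun p : ℕ => p.Prime ∧ (p : ℝ) ≤ Real.sqrt N),
    (Real.log p : ℂ) * eu ((p : ℝ) ^ 2 * α)

/-- `∑_{X < p ≤ 2X} (log p) e(p³α)`; `S = cubeSum U`, `T = cubeSum V`. -/
def cubeSum (X : ℝ) (α : ℝ) : ℂ :=
  ∑ p ∈ (Finset.range (⌊2 * X⌋₊ + 1)).filter
      (fun p : ℕ => p.Prime ∧ X < (p : ℝ) ∧ (p : ℝ) ≤ 2 * X),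
    (Real.log p : ℂ) * eu ((p : ℝ) ^ 3 * α)

/-- `G(α) = ∑_{1 ≤ v ≤ L} e(2^v α)`. -/
def Gsum (L : ℝ) (α : ℝ) : ℂ := ∑ v ∈ Finset.Icc 1 ⌊L⌋₊, eu ((2 : ℝ) ^ v * α)

/-- the major arcs `𝔐 = ⋃_{q ≤ P} ⋃_{1 ≤ a ≤ q, (a,q)=1} {α ∈ [0,1] : |α - a/q| ≤ 1/(qQ)}`. -/
def majorArcs (P Q : ℝ) : Set ℝ :=
  {α | α ∈ Set.Icc (0 : ℝ) 1 ∧ ∃ q a : ℕ, 1 ≤ q ∧ (q : ℝ) ≤ P ∧ 1 ≤ a ∧ a ≤ q ∧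
    Nat.gcd a q = 1 ∧ |α - (a : ℝ) / q| ≤ 1 / ((q : ℝ) * Q)}

/-- the minor arcs `C(𝔐) = [1/Q, 1 + 1/Q] \ 𝔐`. -/
def minorArcs (P Q : ℝ) : Set ℝ := Set.Icc (1 / Q) (1 + 1 / Q) \ majorArcs P Q

/-- Sums over reduced residues mod `p` as sums over nonzero elements of `ZMod p`. -/
lemma sum_reduced_eq (p : ℕ) [Fact p.Prime] (f : ℕ → ℂ) (F : ZMod p → ℂ)
    (h : ∀ m : ℕ, f m = F m) :
    ∑ m ∈ (Finset.Icc 1 p).filter (fun m => Nat.gcd m p = 1), f m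
      = ∑ x ∈ Finset.univ.erase (0 : ZMod p), F x := by
  have hp : p.Prime := Fact.out
  refine Finset.sum_nbij (fun m => (m : ZMod p)) ?_ ?_ ?_ ?_
  · intro m hm
    simp only [Finset.mem_filter, Finset.mem_Icc] at hm
    simp only [Finset.mem_erase, Finset.mem_univ, and_true]
    rw [Ne, ZMod.natCast_eq_zero_iff]
    intro hd
    have := Nat.gcd_eq_right hd
    rw [hm.2] at this
    exact hp.one_lt.ne this
  · intro a ha b hb hab
    simp only [Finset.coe_filter, Finset.mem_Icc, Set.mem_ofPred_eq] at ha hb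
    have hlt : ∀ m : ℕ, (1 ≤ m ∧ m ≤ p) ∧ m.gcd p = 1 → m < p := by
      intro m hm
      refine lt_of_le_of_ne hm.1.2 ?_
      rintro rfl
      rw [Nat.gcd_self] at hm
      exact hp.one_lt.ne' hm.2
    have := (ZMod.natCast_eq_natCast_iff' a b p).1 hab
    rwa [Nat.mod_eq_of_lt (hlt a ha), Nat.mod_eq_of_lt (hlt b hb)] at this
  · intro x hx
    simp only [Finset.coe_erase, Finset.coe_univ, Set.mem_sdiff, Set.mem_univ,
      Set.mem_singleton_iff, true_and] at hx
    refine ⟨x.val, ?_, ?_⟩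
    · simp only [Finset.coe_filter, Finset.mem_Icc, Set.mem_ofPred_eq]
      have h0 : 0 < x.val := Nat.pos_of_ne_zero (by simpa [ZMod.val_eq_zero] using hx)
      have h1 := ZMod.val_lt x
      refine ⟨⟨h0, h1.le⟩, ?_⟩
      exact (Nat.coprime_of_lt_prime h0.ne' h1 hp).symm
    · exact ZMod.natCast_zmod_val x
  · intro m _
    exact h m

lemma eu_eq_std (p : ℕ) [NeZero p] (j : ℤ) (x : ℝ) (hx : x = (j : ℝ) / p) :
    eu x = ZMod.stdAddChar (j : ZMod p) := by
  rw [ZMod.stdAddChar_coe, eu, hx]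
  push_cast
  congr 1
  ring

lemma Cq_eq (i p a : ℕ) [Fact p.Prime] :
    Cq i p a = ∑ x ∈ Finset.univ.erase (0 : ZMod p), ZMod.stdAddChar ((a : ZMod p) * x ^ i) := by
  unfold Cq
  refine sum_reduced_eq p _ (fun x => ZMod.stdAddChar ((a : ZMod p) * x ^ i)) ?_
  intro m
  rw [eu_eq_std p ((a : ℤ) * (m : ℤ) ^ i) _ (by push_cast; rfl)]
  push_cast
  rfl

lemma conj_std (p : ℕ) [NeZero p] (x : ZMod p) :
    (starRingEnd ℂ) (ZMod.stdAddChar x) = ZMod.stdAddChar (-x) :=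
  (AddChar.map_neg_eq_conj _ x).symm

lemma norm_std (p : ℕ) [NeZero p] (x : ZMod p) : ‖(ZMod.stdAddChar x : ℂ)‖ = 1 :=
  AddChar.norm_apply _ x

lemma sum_std (p : ℕ) [NeZero p] (b : ZMod p) :
    ∑ x : ZMod p, (ZMod.stdAddChar (x * b) : ℂ) = if b = 0 then (p : ℂ) else 0 := by
  have := AddChar.sum_mulShift b (ZMod.isPrimitive_stdAddChar p)
  rw [this]
  split_ifs <;> simp [ZMod.card]

lemma gauss_sq (p : ℕ) [Fact p.Prime] (hp2 : p ≠ 2) (a : ZMod p) (ha : a ≠ 0) :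
    ‖∑ x : ZMod p, (ZMod.stdAddChar (a * x ^ 2) : ℂ)‖ ^ 2 = p := by
  have hp : p.Prime := Fact.out
  have h2 : (2 : ZMod p) ≠ 0 := by
    have : ((2 : ℕ) : ZMod p) ≠ 0 := by
      rw [Ne, ZMod.natCast_eq_zero_iff]
      intro h
      exact hp2 ((Nat.prime_dvd_prime_iff_eq hp Nat.prime_two).1 h)
    simpa using this
  have key : ((‖∑ x : ZMod p, (ZMod.stdAddChar (a * x ^ 2) : ℂ)‖ ^ 2 : ℝ) : ℂ) = (p : ℂ) := by
    push_cast
    rw [← Complex.mul_conj', map_sum, Finset.sum_mul_sum, Finset.sum_comm]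
    simp_rw [conj_std, ← AddChar.map_add_eq_mul]
    calc ∑ y : ZMod p, ∑ x : ZMod p, (ZMod.stdAddChar (a * x ^ 2 + -(a * y ^ 2)) : ℂ)
        = ∑ y : ZMod p, ∑ t : ZMod p,
            (ZMod.stdAddChar (a * t ^ 2) * ZMod.stdAddChar (y * (2 * a * t)) : ℂ) := by
          refine Finset.sum_congr rfl fun y _ => ?_
          rw [← Equiv.sum_comp (Equiv.addRight y)]
          refine Finset.sum_congr rfl fun t _ => ?_
          rw [← AddChar.map_add_eq_mul]
          congr 1
          simp only [Equiv.coe_addRight]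
          ring
      _ = ∑ t : ZMod p, (ZMod.stdAddChar (a * t ^ 2) : ℂ) *
            (if 2 * a * t = 0 then (p : ℂ) else 0) := by
          rw [Finset.sum_comm]
          refine Finset.sum_congr rfl fun t _ => ?_
          rw [← Finset.mul_sum, sum_std]
      _ = (p : ℂ) := by
          rw [Finset.sum_eq_single 0]
          · simp
          · intro t _ ht
            rw [if_neg (mul_ne_zero (mul_ne_zero h2 ha) ht), mul_zero]
          · simp
  exact_mod_cast key

lemma C2_bound (p : ℕ) [Fact p.Prime] (hp2 : p ≠ 2) (a : ZMod p) (ha : a ≠ 0) :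
    ‖∑ x ∈ Finset.univ.erase (0 : ZMod p), (ZMod.stdAddChar (a * x ^ 2) : ℂ)‖
      ≤ Real.sqrt p + 1 := by
  have h := gauss_sq p hp2 a ha
  have h1 : ‖∑ x : ZMod p, (ZMod.stdAddChar (a * x ^ 2) : ℂ)‖ = Real.sqrt p := by
    rw [← h, Real.sqrt_sq (norm_nonneg _)]
  have h2 := Finset.sum_erase_eq_sub (f := fun x : ZMod p =>
    (ZMod.stdAddChar (a * x ^ 2) : ℂ)) (Finset.mem_univ (0 : ZMod p))
  rw [h2, ← h1]
  refine (norm_sub_le _ _).trans ?_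
  rw [norm_std]

/-- Second moment of the cubic sums. -/
lemma C3_moment (p : ℕ) [Fact p.Prime] (k : ℕ)
    (hk : ∀ y : ZMod p, ((Finset.univ.erase (0 : ZMod p)).filter
      (fun x => x ^ 3 = y ^ 3)).card ≤ k) :
    ∑ a ∈ Finset.univ.erase (0 : ZMod p),
      ‖∑ x ∈ Finset.univ.erase (0 : ZMod p), (ZMod.stdAddChar (a * x ^ 3) : ℂ)‖ ^ 2
      ≤ ((p : ℝ) - 1) * (k * p - p + 1) := by
  have hp : p.Prime := Fact.out
  have hcard : ((Finset.univ.erase (0 : ZMod p)).card : ℝ) = (p : ℝ) - 1 := by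
    rw [Finset.card_erase_of_mem (Finset.mem_univ _), Finset.card_univ, ZMod.card,
      Nat.cast_sub hp.one_lt.le, Nat.cast_one]
  set E := Finset.univ.erase (0 : ZMod p) with hE
  have hall : ((∑ a : ZMod p, ‖∑ x ∈ E, (ZMod.stdAddChar (a * x ^ 3) : ℂ)‖ ^ 2 : ℝ) : ℂ)
      = ((∑ y ∈ E, (p : ℝ) * ((E.filter (fun x => x ^ 3 = y ^ 3)).card : ℝ) : ℝ) : ℂ) := by
    push_cast
    simp_rw [← Complex.mul_conj', map_sum, Finset.sum_mul_sum, conj_std,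
      ← AddChar.map_add_eq_mul]
    calc ∑ a : ZMod p, ∑ x ∈ E, ∑ y ∈ E, (ZMod.stdAddChar (a * x ^ 3 + -(a * y ^ 3)) : ℂ)
        = ∑ y ∈ E, ∑ x ∈ E, ∑ a : ZMod p, (ZMod.stdAddChar (a * (x ^ 3 - y ^ 3)) : ℂ) := by
          rw [Finset.sum_comm]
          conv_lhs => enter [2, x]; rw [Finset.sum_comm]
          rw [Finset.sum_comm]
          refine Finset.sum_congr rfl fun y _ => Finset.sum_congr rfl fun x _ =>
            Finset.sum_congr rfl fun a _ => ?_
          congr 1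
          ring
      _ = _ := by
          refine Finset.sum_congr rfl fun y _ => ?_
          simp_rw [sum_std, sub_eq_zero]
          rw [← Finset.sum_filter, Finset.sum_const, nsmul_eq_mul, mul_comm]
  have hall' := Complex.ofReal_injective hall
  have hle : ∑ y ∈ E, (p : ℝ) * ((E.filter (fun x => x ^ 3 = y ^ 3)).card : ℝ)
      ≤ ((p : ℝ) - 1) * (p * k) := by
    rw [← hcard, ← nsmul_eq_mul]
    refine Finset.sum_le_card_nsmul _ _ _ fun y _ => ?_
    have : ((E.filter (fun x => x ^ 3 = y ^ 3)).card : ℝ) ≤ k := by exact_mod_cast hk y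
    gcongr
  have h0 := Finset.sum_erase_eq_sub (f := fun a : ZMod p =>
    ‖∑ x ∈ E, (ZMod.stdAddChar (a * x ^ 3) : ℂ)‖ ^ 2) (Finset.mem_univ (0 : ZMod p))
  have hz : ‖∑ x ∈ E, (ZMod.stdAddChar ((0 : ZMod p) * x ^ 3) : ℂ)‖ ^ 2 = ((p : ℝ) - 1) ^ 2 := by
    simp only [zero_mul, AddChar.map_zero_eq_one, Finset.sum_const, nsmul_eq_mul, mul_one]
    rw [← hcard]
    simp
  rw [hE, ← hE] at h0
  rw [h0, hall', hz]
  nlinarith [hle]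

lemma cube_count_three (p : ℕ) [Fact p.Prime] (y : ZMod p) :
    ((Finset.univ.erase (0 : ZMod p)).filter (fun x => x ^ 3 = y ^ 3)).card ≤ 3 := by
  refine le_trans (Finset.card_le_card (t := (Polynomial.nthRoots 3 (y ^ 3)).toFinset) ?_)
    ((Multiset.toFinset_card_le _).trans (Polynomial.card_nthRoots 3 (y ^ 3)))
  intro x hx
  rw [Finset.mem_filter] at hx
  rw [Multiset.mem_toFinset, Polynomial.mem_nthRoots (by norm_num)]
  exact hx.2

lemma cube_count_one (p : ℕ) [Fact p.Prime] (h : p % 3 = 2) (y : ZMod p) :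
    ((Finset.univ.erase (0 : ZMod p)).filter (fun x => x ^ 3 = y ^ 3)).card ≤ 1 := by
  have hinv : ∀ x : ZMod p, (x ^ 3) ^ (2 * (p / 3) + 1) = x := by
    intro x
    have e : 3 * (2 * (p / 3) + 1) + 1 = 2 * p := by omega
    by_cases hx : x = 0
    · subst hx; simp
    have h1 : x ^ (2 * p) = x * x := by
      rw [mul_comm, pow_mul, ZMod.pow_card, sq]
    rw [← pow_mul]
    rw [← e, pow_succ] at h1
    exact mul_right_cancel₀ hx h1
  rw [Finset.card_le_one]
  intro a ha b hb
  rw [Finset.mem_filter] at ha hb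
  rw [← hinv a, ← hinv b, ha.2, hb.2]

lemma Afun_bound (n p : ℕ) [Fact p.Prime] (hp2 : p ≠ 2) (k : ℕ)
    (hk : ∀ y : ZMod p, ((Finset.univ.erase (0 : ZMod p)).filter
      (fun x => x ^ 3 = y ^ 3)).card ≤ k) :
    |Afun n p| ≤ (Real.sqrt p + 1) * (k * p - p + 1) / ((p : ℝ) - 1) ^ 3 := by
  have hp : p.Prime := Fact.out
  have hp1 : (0 : ℝ) < (p : ℝ) - 1 := by
    have : (1 : ℝ) < p := by exact_mod_cast hp.one_lt
    linarith
  unfold Afun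
  refine (Complex.abs_re_le_norm _).trans ?_
  rw [sum_reduced_eq p _ (fun a : ZMod p =>
    (∑ x ∈ Finset.univ.erase (0 : ZMod p), (ZMod.stdAddChar (a * x ^ 2) : ℂ)) *
    (∑ x ∈ Finset.univ.erase (0 : ZMod p), (ZMod.stdAddChar (a * x ^ 3) : ℂ)) ^ 2 *
      ZMod.stdAddChar (-(a * (n : ZMod p))))
    (by
      intro m
      rw [Cq_eq, Cq_eq, eu_eq_std p (-((m : ℤ) * (n : ℤ))) _ (by push_cast; rfl)]
      push_cast
      rfl)]
  rw [norm_mul, norm_div, ArithmeticFunction.moebius_apply_prime hp, Nat.totient_prime hp]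
  have hsum : ‖∑ a ∈ Finset.univ.erase (0 : ZMod p),
      (∑ x ∈ Finset.univ.erase (0 : ZMod p), (ZMod.stdAddChar (a * x ^ 2) : ℂ)) *
      (∑ x ∈ Finset.univ.erase (0 : ZMod p), (ZMod.stdAddChar (a * x ^ 3) : ℂ)) ^ 2 *
      ZMod.stdAddChar (-(a * (n : ZMod p)))‖ ≤
      (Real.sqrt p + 1) * (((p : ℝ) - 1) * (k * p - p + 1)) := by
    refine (norm_sum_le _ _).trans ?_
    refine le_trans ?_ (mul_le_mul_of_nonneg_left (C3_moment p k hk) (by positivity))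
    rw [Finset.mul_sum]
    refine Finset.sum_le_sum fun a ha => ?_
    rw [norm_mul, norm_mul, norm_std, mul_one, norm_pow]
    exact mul_le_mul_of_nonneg_right (C2_bound p hp2 a (Finset.ne_of_mem_erase ha))
      (by positivity)
  have hn : ‖(((-1 : ℤ) : ℂ))‖ / ‖((p - 1 : ℕ) : ℂ) ^ 4‖ = 1 / ((p : ℝ) - 1) ^ 4 := by
    rw [norm_pow, Complex.norm_natCast, Nat.cast_sub hp.one_lt.le]
    simp
  rw [hn]
  refine (mul_le_mul_of_nonneg_left hsum (by positivity)).trans (le_of_eq ?_)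
  field_simp

/-- Comparison function. -/
def bb (m : ℕ) : ℝ :=
  if m % 6 = 1 then (Real.sqrt m + 1) * (2 * m + 1) / ((m : ℝ) - 1) ^ 3
  else if m % 6 = 5 then (Real.sqrt m + 1) / ((m : ℝ) - 1) ^ 3 else 0

lemma Afun_le_bb (n p : ℕ) (hp : p.Prime) (h : 199 < p) : |Afun n p| ≤ bb p := by
  haveI : Fact p.Prime := ⟨hp⟩
  have h2 : ¬ 2 ∣ p := fun hd => by
    have := (Nat.prime_dvd_prime_iff_eq Nat.prime_two hp).1 hd
    omega
  have h3 : ¬ 3 ∣ p := fun hd => by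
    have := (Nat.prime_dvd_prime_iff_eq Nat.prime_three hp).1 hd
    omega
  unfold bb
  split_ifs with h1 h5
  · refine (Afun_bound n p (by omega) 3 (cube_count_three p)).trans (le_of_eq ?_)
    push_cast
    ring
  · refine (Afun_bound n p (by omega) 1 (cube_count_one p (by omega))).trans (le_of_eq ?_)
    push_cast
    ring
  · omega

lemma bb_nonneg (m : ℕ) (hm : 1 ≤ m) : 0 ≤ bb m := by
  have : (0 : ℝ) ≤ (m : ℝ) - 1 := by
    have : (1 : ℝ) ≤ m := by exact_mod_cast hm
    linarith
  unfold bb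
  split_ifs <;> positivity

lemma telescope (k : ℝ) (hk : 35 ≤ k) :
    1 / (k * Real.sqrt k) ≤ 2 / Real.sqrt (k - 1) - 2 / Real.sqrt k := by
  have ha : 0 < Real.sqrt (k - 1) := Real.sqrt_pos.2 (by linarith)
  have hb : 0 < Real.sqrt k := Real.sqrt_pos.2 (by linarith)
  have hab : Real.sqrt (k - 1) ≤ Real.sqrt k := Real.sqrt_le_sqrt (by linarith)
  have sa : Real.sqrt (k - 1) ^ 2 = k - 1 := Real.sq_sqrt (by linarith)
  have sb : Real.sqrt k ^ 2 = k := Real.sq_sqrt (by linarith)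
  set a := Real.sqrt (k - 1)
  set b := Real.sqrt k
  rw [div_sub_div _ _ ha.ne' hb.ne', ← sb, div_le_div_iff₀ (by positivity) (by positivity)]
  have h1 : (b - a) * (b + a) = 1 := by nlinarith
  have h2 : a * b ≤ (2 * b ^ 2) * (b - a) * b := by
    have h3 : (b - a) * (2 * b) ≥ 1 := by nlinarith
    nlinarith [mul_le_mul_of_nonneg_left h3 (sq_nonneg b), mul_le_mul_of_nonneg_right hab hb.le]
  nlinarith

lemma step_bound (k : ℕ) (hk : 35 ≤ k) :
    bb (6 * k + 1) + bb (6 * k + 5) ≤ 0.15 * (1 / ((k : ℝ) * Real.sqrt k)) := by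
  have hkr : (35 : ℝ) ≤ k := by exact_mod_cast hk
  have hk0 : (0 : ℝ) < k := by linarith
  have hb : 0 < Real.sqrt k := Real.sqrt_pos.2 hk0
  have sb : Real.sqrt k ^ 2 = k := Real.sq_sqrt hk0.le
  have hb5 : (5.916 : ℝ) ≤ Real.sqrt k := Real.le_sqrt_of_sq_le (by norm_num; linarith)
  have e1 : bb (6 * k + 1) = (Real.sqrt (6 * k + 1) + 1) * (12 * k + 3) / (6 * (k : ℝ)) ^ 3 := by
    unfold bb
    rw [if_pos (by omega)]
    push_cast
    congr 1 <;> ring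
  have e2 : bb (6 * k + 5) = (Real.sqrt (6 * k + 5) + 1) / (6 * (k : ℝ) + 4) ^ 3 := by
    unfold bb
    rw [if_neg (by omega), if_pos (by omega)]
    push_cast
    congr 2 ; ring
  have r1 : Real.sqrt (6 * k + 1) + 1 ≤ 2.6255 * Real.sqrt k := by
    have : Real.sqrt (6 * k + 1) ≤ 2.6255 * Real.sqrt k - 1 := by
      rw [Real.sqrt_le_iff]
      constructor
      · nlinarith
      · nlinarith
    linarith
  have r2 : Real.sqrt (6 * k + 5) + 1 ≤ 3 * Real.sqrt k := by
    have : Real.sqrt (6 * k + 5) ≤ 3 * Real.sqrt k - 1 := by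
      rw [Real.sqrt_le_iff]
      constructor
      · nlinarith
      · nlinarith
    linarith
  have f1 : bb (6 * k + 1) ≤ 0.147 * (1 / ((k : ℝ) * Real.sqrt k)) := by
    rw [e1]
    calc (Real.sqrt (6 * k + 1) + 1) * (12 * k + 3) / (6 * (k : ℝ)) ^ 3
        ≤ (2.6255 * Real.sqrt k) * ((12 + 3 / 35) * k) / (6 * (k : ℝ)) ^ 3 := by
          gcongr
          linarith
      _ = (2.6255 * (12 + 3 / 35) / 216) * (Real.sqrt k / (k : ℝ) ^ 2) := by
          field_simp
          ring
      _ = (2.6255 * (12 + 3 / 35) / 216) * (1 / ((k : ℝ) * Real.sqrt k)) := by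
          congr 1
          rw [div_eq_div_iff (by positivity) (by positivity)]
          nlinarith
      _ ≤ _ := by
          gcongr
          norm_num
  have f2 : bb (6 * k + 5) ≤ 0.003 * (1 / ((k : ℝ) * Real.sqrt k)) := by
    rw [e2]
    calc (Real.sqrt (6 * k + 5) + 1) / (6 * (k : ℝ) + 4) ^ 3
        ≤ (3 * Real.sqrt k) / (6 * (k : ℝ)) ^ 3 := by
          gcongr
          linarith
      _ = (3 / 216 / k) * (Real.sqrt k / (k : ℝ) ^ 2) := by
          field_simp
          ring
      _ = (3 / 216 / k) * (1 / ((k : ℝ) * Real.sqrt k)) := by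
          congr 1
          rw [div_eq_div_iff (by positivity) (by positivity)]
          nlinarith
      _ ≤ _ := by
          gcongr
          rw [div_le_iff₀ hk0]
          linarith
  linarith

lemma sum_bb (j : ℕ) :
    ∑ m ∈ Finset.range (6 * j), bb (210 + m)
      ≤ 0.3 / Real.sqrt 34 - 0.3 / Real.sqrt ((j : ℝ) + 34) := by
  induction j with
  | zero => simp
  | succ j ih =>
    have e : 6 * (j + 1) = 6 * j + 6 := by ring
    rw [e]
    simp only [Finset.sum_range_succ]
    have z0 : bb (210 + (6 * j)) = 0 := by
      unfold bb; rw [if_neg (by omega), if_neg (by omega)]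
    have z2 : bb (210 + (6 * j + 2)) = 0 := by
      unfold bb; rw [if_neg (by omega), if_neg (by omega)]
    have z3 : bb (210 + (6 * j + 3)) = 0 := by
      unfold bb; rw [if_neg (by omega), if_neg (by omega)]
    have z4 : bb (210 + (6 * j + 4)) = 0 := by
      unfold bb; rw [if_neg (by omega), if_neg (by omega)]
    have hs := step_bound (j + 35) (by omega)
    have ht := telescope ((j : ℝ) + 35) (by linarith [Nat.cast_nonneg (α := ℝ) j])
    have e1 : 6 * (j + 35) + 1 = 210 + (6 * j + 1) := by ring
    have e5 : 6 * (j + 35) + 5 = 210 + (6 * j + 5) := by ring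
    rw [e1, e5] at hs
    push_cast at hs ⊢
    have e34 : (j : ℝ) + 35 - 1 = j + 34 := by ring
    have e35 : (j : ℝ) + 1 + 34 = j + 35 := by ring
    rw [e34] at ht
    rw [z0, z2, z3, z4, e35]
    have q1 : (0.3 : ℝ) / Real.sqrt (j + 34) = 0.15 * (2 / Real.sqrt (j + 34)) := by ring
    have q2 : (0.3 : ℝ) / Real.sqrt (j + 35) = 0.15 * (2 / Real.sqrt (j + 35)) := by ring
    rw [q2]
    rw [q1] at ih
    linarith

lemma sum_Afun_le (n : ℕ) (u : Finset {p : ℕ // p.Prime ∧ 199 < p}) :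
    ∑ p ∈ u, ‖Afun n p‖ ≤ 0.0515 := by
  have hge : ∀ p : {p : ℕ // p.Prime ∧ 199 < p}, 210 ≤ (p : ℕ) := by
    rintro ⟨p, hp, h⟩
    by_contra hlt
    push Not at hlt
    simp only at hlt
    interval_cases p <;> revert hp <;> norm_num
  have hsub : ∑ p ∈ u, bb p = ∑ m ∈ u.image (fun p : {p : ℕ // p.Prime ∧ 199 < p} => (p : ℕ) - 210), bb (210 + m) := by
    rw [Finset.sum_image]
    · refine Finset.sum_congr rfl fun p _ => ?_
      rw [Nat.add_sub_cancel' (hge p)]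
    · intro a _ b _ hab
      have h1 := hge a
      have h2 := hge b
      apply Subtype.ext
      simp only at hab
      omega
  obtain ⟨N, hN⟩ := Finset.exists_nat_subset_range (u.image (fun p : {p : ℕ // p.Prime ∧ 199 < p} => (p : ℕ) - 210))
  calc ∑ p ∈ u, ‖Afun n p‖ ≤ ∑ p ∈ u, bb p :=
        Finset.sum_le_sum fun p _ => Afun_le_bb n p p.2.1 p.2.2
    _ = _ := hsub
    _ ≤ ∑ m ∈ Finset.range (6 * N), bb (210 + m) := by
        refine Finset.sum_le_sum_of_subset_of_nonneg
          (hN.trans (Finset.range_mono (by omega))) fun m _ _ => bb_nonneg _ (by omega)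
    _ ≤ 0.3 / Real.sqrt 34 - 0.3 / Real.sqrt ((N : ℝ) + 34) := sum_bb N
    _ ≤ 0.3 / Real.sqrt 34 := by
        have : 0 ≤ 0.3 / Real.sqrt ((N : ℝ) + 34) := by positivity
        linarith
    _ ≤ 0.0515 := by
        have : (5.83 : ℝ) ≤ Real.sqrt 34 := Real.le_sqrt_of_sq_le (by norm_num)
        rw [div_le_iff₀ (by positivity)]
        linarith

/-- The product `∏_{p > 199 prime} (1 + A(n,p))` converges and is at least `0.943671`. -/
theorem singular_tail_lower_bound (n : ℕ) (hn : 0 < n) :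
    Multipliable (fun p : {p : ℕ // p.Prime ∧ 199 < p} => 1 + Afun n p) ∧
    ∏' p : {p : ℕ // p.Prime ∧ 199 < p}, (1 + Afun n p) ≥ 0.943671 := by
  have hsum : Summable (fun p : {p : ℕ // p.Prime ∧ 199 < p} => ‖Afun n p‖) :=
    summable_of_sum_le (fun _ => norm_nonneg _) (sum_Afun_le n)
  have hm : Multipliable (fun p : {p : ℕ // p.Prime ∧ 199 < p} => 1 + Afun n p) :=
    multipliable_one_add_of_summable hsum
  refine ⟨hm, ?_⟩
  refine ge_of_tendsto' hm.hasProd fun u => ?_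
  have h1 := Finset.norm_prod_one_add_sub_one_le u
    (fun p : {p : ℕ // p.Prime ∧ 199 < p} => Afun n p)
  have h2 : Real.exp (∑ p ∈ u, ‖Afun n p‖) ≤ 1 / (1 - 0.0515) :=
    (Real.exp_le_exp.2 (sum_Afun_le n u)).trans
      (Real.exp_bound_div_one_sub_of_interval (by norm_num) (by norm_num))
  have h3 := neg_abs_le (∏ p ∈ u, (1 + Afun n p) - 1)
  rw [Real.norm_eq_abs] at h1
  norm_num at h2 ⊢
  norm_num at h1
  linarith
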